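/- Let γ, ν > 0 and u ∈ C²(ℝ³;ℝ³) with bounded derivatives, ω = ∇×u. For every 0 ≤ k ≤ N−1, Ω_k Ψ[u,C] = ⟨ω⟩_k(C_k) Ψ[u,C] − R^k_{ad} Ψ[u,C] − (iγ/ν) Ψ[u,C] (∇_{C_{k+1}} Γ[u,C]) × (∇_{C_k} Γ[u,C]), where R^k_{ad} := ∇_{C_{k+1}} × ∇_{C_k} Γ[u,C] + ⟨ω⟩_k(C_k) satisfies |R^k_{ad}| ≤ c ‖Dω‖_{L^∞} |C_{k+1} − C_{k-1}| for a universal constant c. -/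

import Mathlib

noncomputable section

open scoped RealInnerProductSpace BigOperators
open MeasureTheory

/-- ℝ³ as a Euclidean space. -/
abbrev E3 : Type := EuclideanSpace ℝ (Fin 3)

/-- The vector of `E3` with the three given coordinates. -/
def vec3 (a b c : ℝ) : E3 := (WithLp.equiv 2 (Fin 3 → ℝ)).symm ![a, b, c]

/-- Cross product on `E3`. -/
def cross3 (v w : E3) : E3 :=
  vec3 (v 1 * w 2 - v 2 * w 1) (v 2 * w 0 - v 0 * w 2) (v 0 * w 1 - v 1 * w 0)

/-- `j`-th standard basis vector of `E3`. -/
def e3 (j : Fin 3) : E3 := EuclideanSpace.single j 1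

/-- Curl (vorticity) of a vector field on `E3`. -/
def curl3 (u : E3 → E3) (x : E3) : E3 :=
  vec3 (fderiv ℝ u x (e3 1) 2 - fderiv ℝ u x (e3 2) 1)
       (fderiv ℝ u x (e3 2) 0 - fderiv ℝ u x (e3 0) 2)
       (fderiv ℝ u x (e3 0) 1 - fderiv ℝ u x (e3 1) 0)

/-- Divergence of a vector field on `E3`. -/
def div3 (u : E3 → E3) (x : E3) : ℝ := ∑ j : Fin 3, fderiv ℝ u x (e3 j) j

/-- Componentwise Laplacian of a vector field on `E3`. -/
def lap3 (u : E3 → E3) (x : E3) : E3 :=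
  ∑ j : Fin 3, fderiv ℝ (fun y => fderiv ℝ u y (e3 j)) x (e3 j)

/-- Transposed Jacobian of `ω` at `x`, applied to `v`:  `((Dω)ᵀ v)_j = ∑_i ∂_j ω_i v_i`. -/
def jacT (ω : E3 → E3) (x v : E3) : E3 :=
  (WithLp.equiv 2 (Fin 3 → ℝ)).symm fun j => ⟪fderiv ℝ ω x (e3 j), v⟫

/-- Sup norm of the `j`-th derivative of a vector field. -/
def supDeriv (j : ℕ) (u : E3 → E3) : ℝ := ⨆ x : E3, ‖iteratedFDeriv ℝ j u x‖

/-- `C^m` norm: maximum of the sup norms of the derivatives of order `≤ m`. -/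
def cNorm (m : ℕ) (u : E3 → E3) : ℝ :=
  (Finset.range (m + 1)).sup' (Finset.nonempty_range_iff.mpr (Nat.succ_ne_zero m))
    fun j => supDeriv j u

/-- Sobolev `H^K` norm. -/
def sobNorm (K : ℕ) (u : E3 → E3) : ℝ :=
  Real.sqrt (∑ j ∈ Finset.range (K + 1), ∫ x : E3, ‖iteratedFDeriv ℝ j u x‖ ^ 2)

/-- Circulation of `u` along the closed polygon with vertices `C 0, …, C (N-1)`. -/
def circulation (N : ℕ) [NeZero N] (u : E3 → E3) (C : Fin N → E3) : ℝ :=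
  ∑ k : Fin N, ∫ a in (0:ℝ)..(1:ℝ), ⟪u ((1 - a) • C k + a • C (k + 1)), C (k + 1) - C k⟫

/-- `⟨ω⟩` : average of `ω` along the segment joining `(xm+xp)/2` to `y`. -/
def segAvg (ω : E3 → E3) (xm y xp : E3) : E3 :=
  ∫ a in (0:ℝ)..(1:ℝ), ω (a • y + (1 - a) • ((2:ℝ)⁻¹ • (xm + xp)))

variable {N : ℕ}

/-- Partial derivative of a real functional of the vertices with respect to
the `j`-th coordinate of the vertex `k`. -/
def vpdR (k : Fin N) (j : Fin 3) (F : (Fin N → E3) → ℝ) (C : Fin N → E3) : ℝ :=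
  fderiv ℝ (fun x => F (Function.update C k x)) (C k) (e3 j)

/-- Gradient of a real functional of the vertices with respect to the vertex `k`. -/
def vgradR (k : Fin N) (F : (Fin N → E3) → ℝ) (C : Fin N → E3) : E3 :=
  gradient (fun x => F (Function.update C k x)) (C k)

/-- `∇_{C_a} × ∇_{C_b}` applied to a real functional of the vertices. -/
def gradCross (a b : Fin N) (F : (Fin N → E3) → ℝ) (C : Fin N → E3) : E3 :=
  vec3 (vpdR a 1 (vpdR b 2 F) C - vpdR a 2 (vpdR b 1 F) C)
       (vpdR a 2 (vpdR b 0 F) C - vpdR a 0 (vpdR b 2 F) C)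
       (vpdR a 0 (vpdR b 1 F) C - vpdR a 1 (vpdR b 0 F) C)

/-- Migdal's area derivative `(∑_{j>k} ∇_{C_j} + ½ ∇_{C_k}) × ∇_{C_k}` on real functionals. -/
def gradCrossM (k : Fin N) (F : (Fin N → E3) → ℝ) (C : Fin N → E3) : E3 :=
  (∑ j ∈ Finset.univ.filter (fun j : Fin N => (k : ℕ) < (j : ℕ)), gradCross j k F C)
    + (2:ℝ)⁻¹ • gradCross k k F C

/-- Partial derivative of a complex functional of the vertices. -/
def vpd (k : Fin N) (j : Fin 3) (F : (Fin N → E3) → ℂ) (C : Fin N → E3) : ℂ :=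
  fderiv ℝ (fun x => F (Function.update C k x)) (C k) (e3 j)

/-- `∇_{C_a} × ∇_{C_b}` on complex functionals. -/
def opCross (a b : Fin N) (F : (Fin N → E3) → ℂ) (C : Fin N → E3) : Fin 3 → ℂ :=
  ![vpd a 1 (vpd b 2 F) C - vpd a 2 (vpd b 1 F) C,
    vpd a 2 (vpd b 0 F) C - vpd a 0 (vpd b 2 F) C,
    vpd a 0 (vpd b 1 F) C - vpd a 1 (vpd b 0 F) C]

/-- `∇_{C_k} ×` applied to a `ℂ³`-valued functional of the vertices. -/
def vcurl (k : Fin N) (G : (Fin N → E3) → Fin 3 → ℂ) (C : Fin N → E3) : Fin 3 → ℂ :=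
  ![vpd k 1 (fun D => G D 2) C - vpd k 2 (fun D => G D 1) C,
    vpd k 2 (fun D => G D 0) C - vpd k 0 (fun D => G D 2) C,
    vpd k 0 (fun D => G D 1) C - vpd k 1 (fun D => G D 0) C]

/-- Embedding of a real vector into `ℂ³`. -/
def toC3 (v : E3) : Fin 3 → ℂ := fun j => (v j : ℂ)

/-- Bilinear (non-hermitian) dot product on `ℂ³`. -/
def cdot (v w : Fin 3 → ℂ) : ℂ := ∑ j : Fin 3, v j * w j

/-- Bilinear cross product on `ℂ³`. -/
def ccross3 (v w : Fin 3 → ℂ) : Fin 3 → ℂ :=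
  ![v 1 * w 2 - v 2 * w 1, v 2 * w 0 - v 0 * w 2, v 0 * w 1 - v 1 * w 0]

/-- Euclidean magnitude of a vector of `ℂ³`. -/
def cnorm3 (v : Fin 3 → ℂ) : ℝ := Real.sqrt (∑ j : Fin 3, Complex.normSq (v j))

/-- Pairing of a real vector with a complex vector. -/
def dotRC (v : E3) (w : Fin 3 → ℂ) : ℂ := ∑ j : Fin 3, (v j : ℂ) * w j

/-- A smooth cut-off `χ` which is `1` on `B_1(0)` and vanishes outside `B_2(0)`. -/
def IsCutoff (χ : E3 → ℝ) : Prop :=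
  ContDiff ℝ ((⊤ : ℕ∞) : WithTop ℕ∞) χ ∧ (∀ x : E3, ‖x‖ ≤ 1 → χ x = 1) ∧ (∀ x : E3, 2 ≤ ‖x‖ → χ x = 0)

/-- Kernel of the regularized Biot–Savart operator: `∇_y (χ(ℓ(x−y))/|x−y|)`. -/
def BSker (χ : E3 → ℝ) (ℓ : ℝ) (x y : E3) : E3 :=
  gradient (fun z => χ (ℓ • (x - z)) / ‖x - z‖) y

/-- Regularized Biot–Savart operator `BS_ℓ`. -/
def BSreg (χ : E3 → ℝ) (ℓ : ℝ) (ω : E3 → E3) (x : E3) : E3 :=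
  (4 * Real.pi)⁻¹ • ∫ y : E3, cross3 (ω y) (BSker χ ℓ x y)

/-- Regularized Biot–Savart operator on `ℂ³`-valued fields (componentwise). -/
def BSregC (χ : E3 → ℝ) (ℓ : ℝ) (ω : E3 → Fin 3 → ℂ) (x : E3) : Fin 3 → ℂ :=
  (4 * Real.pi)⁻¹ • ∫ y : E3, ccross3 (ω y) (toC3 (BSker χ ℓ x y))

/-- The discretized vorticity operator `Ω_k = (iν/γ) ∇_{C_{k+1}} × ∇_{C_k}`. -/
def vortOp [NeZero N] (γ ν : ℝ) (k : Fin N) (F : (Fin N → E3) → ℂ) (C : Fin N → E3) :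
    Fin 3 → ℂ :=
  (Complex.I * ν / γ) • opCross (k + 1) k F C

/-- The discretized diffusion operator `𝒟_k = 2 ∇_{C_k} × Ω_k`. -/
def diffOp [NeZero N] (γ ν : ℝ) (k : Fin N) (F : (Fin N → E3) → ℂ) (C : Fin N → E3) :
    Fin 3 → ℂ :=
  (2:ℂ) • vcurl k (vortOp γ ν k F) C

/-- The discretized velocity operator `U_k = (1/log(1/ρ)) BS_ℓ ∘ Ω_k`,
with `BS_ℓ` acting in the variable `C_k`. -/
def velOp [NeZero N] (χ : E3 → ℝ) (ℓ ρ γ ν : ℝ) (k : Fin N) (F : (Fin N → E3) → ℂ)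
    (C : Fin N → E3) : Fin 3 → ℂ :=
  (Real.log (1 / ρ))⁻¹ • BSregC χ ℓ (fun x => vortOp γ ν k F (Function.update C k x)) (C k)

/-- Levi-Civita symbol on `Fin 3`. -/
def levi3 (a b c : Fin 3) : ℝ :=
  if (a, b, c) = (0, 1, 2) ∨ (a, b, c) = (1, 2, 0) ∨ (a, b, c) = (2, 0, 1) then 1
  else if (a, b, c) = (2, 1, 0) ∨ (a, b, c) = (1, 0, 2) ∨ (a, b, c) = (0, 2, 1) then -1
  else 0

/-- The discretized advection operator `(Ω_{k+3} × U_k)_α = ε_{αij} Ω^i_{k+3} ∘ U^j_k`. -/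
def advecOp [NeZero N] (χ : E3 → ℝ) (ℓ ρ γ ν : ℝ) (k : Fin N) (F : (Fin N → E3) → ℂ)
    (C : Fin N → E3) : Fin 3 → ℂ :=
  fun α => ∑ i : Fin 3, ∑ j : Fin 3,
    (levi3 α i j : ℂ) * vortOp γ ν (k + 3) (fun D => velOp χ ℓ ρ γ ν k F D j) C i

/-- Migdal's discretized vorticity operator
`Ω^M_k = (iν/γ)(∑_{j=k+1}^{N-1} ∇_{C_j} + ½∇_{C_k}) × ∇_{C_k}`. -/
def vortOpM [NeZero N] (γ ν : ℝ) (k : Fin N) (F : (Fin N → E3) → ℂ) (C : Fin N → E3) :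
    Fin 3 → ℂ :=
  (Complex.I * ν / γ) •
    ((∑ j ∈ Finset.univ.filter (fun j : Fin N => (k : ℕ) < (j : ℕ)), opCross j k F C)
      + (2:ℂ)⁻¹ • opCross k k F C)

/-- Migdal's discretized diffusion operator `𝒟^M_k = 2 ∇_{C_k} × Ω^M_k`. -/
def diffOpM [NeZero N] (γ ν : ℝ) (k : Fin N) (F : (Fin N → E3) → ℂ) (C : Fin N → E3) :
    Fin 3 → ℂ :=
  (2:ℂ) • vcurl k (vortOpM γ ν k F) C

/-- Migdal's discretized velocity operator `U^M_k = (1/log(1/ρ)) BS_ℓ ∘ Ω^M_k`. -/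
def velOpM [NeZero N] (χ : E3 → ℝ) (ℓ ρ γ ν : ℝ) (k : Fin N) (F : (Fin N → E3) → ℂ)
    (C : Fin N → E3) : Fin 3 → ℂ :=
  (Real.log (1 / ρ))⁻¹ • BSregC χ ℓ (fun x => vortOpM γ ν k F (Function.update C k x)) (C k)

/-- The loop functional `Ψ[u,C] = exp((iγ/ν) Γ[u,C])` as a function of the vertices. -/
def loopExp (γ ν : ℝ) (N : ℕ) [NeZero N] (u : E3 → E3) (C : Fin N → E3) : ℂ :=
  Complex.exp (Complex.I * γ / ν * (circulation N u C : ℂ))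

/-- The momentum loop functional `Ψ[P,C](t) = exp((iγ/ν) ∑_k P_k(t)·ΔC_k)`. -/
def momFun (γ ν : ℝ) (N : ℕ) [NeZero N] (P : Fin N → ℝ → Fin 3 → ℂ) (t : ℝ)
    (C : Fin N → E3) : ℂ :=
  Complex.exp (Complex.I * γ / ν * ∑ k : Fin N, cdot (P k t) (toC3 (C (k + 1) - C k)))

/-- The expression `E_k` of the discretized momentum loop equation, as a function of
`ΔP_{k-1}, ΔP_k, ΔP_{k+2}, ΔP_{k+3}` (and of `log N`). -/
def EkDef (γ ν NR : ℝ) (dPm dP dP2 dP3 : Fin 3 → ℂ) : Fin 3 → ℂ :=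
  ((Real.log NR)⁻¹ : ℂ) •
      ((Complex.I * γ / ν) •
        ccross3 (ccross3 dP3 dP2) (dP - (cdot dPm dP / cdot dPm dPm) • dPm))
    + ((2 * γ ^ 2 / ν : ℝ) : ℂ) • (cdot dPm dPm • dP - cdot dPm dP • dPm)

/-- Differentiation under the integral sign over `[0, 1]` for a jointly continuous derivative. -/
theorem hasFDerivAt_integral_of_continuous_fderiv {H E : Type*} [NormedAddCommGroup H]
    [NormedSpace ℝ H] [ProperSpace H] [NormedAddCommGroup E] [NormedSpace ℝ E]
    {F : H → ℝ → E} {F' : H → ℝ → H →L[ℝ] E} (hF : ∀ x, Continuous (F x))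
    (hF' : Continuous fun p : H × ℝ => F' p.1 p.2)
    (hd : ∀ x t, HasFDerivAt (fun x => F x t) (F' x t) x) (x₀ : H) :
    HasFDerivAt (fun x => ∫ t in (0:ℝ)..1, F x t) (∫ t in (0:ℝ)..1, F' x₀ t) x₀ := by
  obtain ⟨M, hM⟩ := ((isCompact_closedBall x₀ 1).prod
    (isCompact_uIcc (a := (0:ℝ)) (b := 1))).exists_bound_of_continuousOn hF'.continuousOn
  have hc : Continuous (F' x₀) := hF'.comp (Continuous.prodMk_right x₀)
  refine intervalIntegral.hasFDerivAt_integral_of_dominated_of_fderiv_le (bound := fun _ => M)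
    (Metric.closedBall_mem_nhds x₀ one_pos)
    (Filter.Eventually.of_forall fun x => (hF x).aestronglyMeasurable)
    ((hF x₀).intervalIntegrable _ _) hc.aestronglyMeasurable
    (Filter.Eventually.of_forall fun t ht x hx => hM (x, t) ⟨hx, Set.uIoc_subset_uIcc ht⟩)
    (continuous_const.intervalIntegrable _ _)
    (Filter.Eventually.of_forall fun t _ x _ => hd x t)

/-- Circulation of `u` along the segment from `x` to `y`. -/
def edgeCirc (u : E3 → E3) (x y : E3) : ℝ :=
  ∫ a in (0:ℝ)..(1:ℝ), ⟪u ((1 - a) • x + a • y), y - x⟫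

theorem edgeCirc_swap (u : E3 → E3) (x y : E3) : edgeCirc u x y = -edgeCirc u y x := by
  unfold edgeCirc
  rw [← intervalIntegral.integral_neg]
  have h := intervalIntegral.integral_comp_sub_left (a := 0) (b := 1)
    (fun a : ℝ => ⟪u ((1 - a) • x + a • y), y - x⟫) 1
  simp only [sub_self, sub_zero, sub_sub_cancel] at h
  rw [← h]
  refine intervalIntegral.integral_congr fun a _ => ?_
  rw [add_comm, ← inner_neg_right, neg_sub]

/-- Derivative in `x` of the integrand of `edgeCirc u x y`. -/
def edgeIntegrandFDeriv (u : E3 → E3) (x y : E3) (a : ℝ) : E3 →L[ℝ] ℝ :=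
  (1 - a) • (innerSL ℝ (y - x)).comp (fderiv ℝ u ((1 - a) • x + a • y))
    - innerSL ℝ (u ((1 - a) • x + a • y))

/-- Derivative of `edgeCirc u x y` in `x`. -/
def edgeFDeriv (u : E3 → E3) (x y : E3) : E3 →L[ℝ] ℝ :=
  ∫ a in (0:ℝ)..(1:ℝ), edgeIntegrandFDeriv u x y a

theorem continuous_edgeIntegrandFDeriv {u : E3 → E3} (hu : ContDiff ℝ 1 u) (y : E3) :
    Continuous fun p : E3 × ℝ => edgeIntegrandFDeriv u p.1 y p.2 := by
  have h0 := hu.continuous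
  have h1 := hu.continuous_fderiv one_ne_zero
  unfold edgeIntegrandFDeriv
  fun_prop

theorem hasFDerivAt_edgeCirc_left {u : E3 → E3} (hu : ContDiff ℝ 1 u) (x y : E3) :
    HasFDerivAt (fun x => edgeCirc u x y) (edgeFDeriv u x y) x := by
  have h0 := hu.continuous
  refine hasFDerivAt_integral_of_continuous_fderiv
    (F := fun x a => ⟪u ((1 - a) • x + a • y), y - x⟫) (F' := fun x => edgeIntegrandFDeriv u x y)
    (fun x => by fun_prop) (continuous_edgeIntegrandFDeriv hu y) (fun x a => ?_) x
  have hp : HasFDerivAt (fun x : E3 => (1 - a) • x + a • y)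
      ((1 - a) • ContinuousLinearMap.id ℝ E3) x :=
    ((hasFDerivAt_id x).const_smul (1 - a)).add_const _
  have h := ((hu.differentiable one_ne_zero _).hasFDerivAt.comp x hp).inner ℝ
    ((hasFDerivAt_id x).const_sub y)
  refine h.congr_fderiv ?_
  ext v
  simp [edgeIntegrandFDeriv, inner_sub_left, inner_smul_left, real_inner_comm]
  ring

theorem hasFDerivAt_edgeCirc_right {u : E3 → E3} (hu : ContDiff ℝ 1 u) (x y : E3) :
    HasFDerivAt (fun y => edgeCirc u x y) (-edgeFDeriv u y x) y := by
  simp_rw [edgeCirc_swap u x]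
  exact (hasFDerivAt_edgeCirc_left hu y x).neg

theorem edgeFDeriv_apply {u : E3 → E3} (hu : ContDiff ℝ 1 u) (x y e : E3) :
    edgeFDeriv u x y e = ∫ a in (0:ℝ)..(1:ℝ), ((1 - a) * ⟪y - x, fderiv ℝ u ((1 - a) • x + a • y) e⟫
      - ⟪u ((1 - a) • x + a • y), e⟫) := by
  have hc : Continuous (edgeIntegrandFDeriv u x y) :=
    (continuous_edgeIntegrandFDeriv hu y).comp (Continuous.prodMk_right x)
  rw [edgeFDeriv, ContinuousLinearMap.intervalIntegral_apply (hc.intervalIntegrable _ _)]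
  simp [edgeIntegrandFDeriv, inner_sub_left]

/-- Derivative in `y` of the integrand of `edgeFDeriv u x y e`. -/
def edgeIntegrandMixed (u : E3 → E3) (x e y : E3) (a : ℝ) : E3 →L[ℝ] ℝ :=
  (1 - a) • (innerSL ℝ (fderiv ℝ u ((1 - a) • x + a • y) e)
      + a • (innerSL ℝ (y - x)).comp
        ((fderiv ℝ (fderiv ℝ u) ((1 - a) • x + a • y)).flip e))
    - a • (innerSL ℝ e).comp (fderiv ℝ u ((1 - a) • x + a • y))

theorem continuous_edgeIntegrandMixed {u : E3 → E3} (hu : ContDiff ℝ 2 u) (x e : E3) :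
    Continuous fun p : E3 × ℝ => edgeIntegrandMixed u x e p.1 p.2 := by
  have h1 := hu.continuous_fderiv two_ne_zero
  have h2 : Continuous (fderiv ℝ (fderiv ℝ u)) :=
    (hu.fderiv_right (m := 1) (by norm_num)).continuous_fderiv one_ne_zero
  have hp : Continuous fun p : E3 × ℝ => (1 - p.2) • x + p.2 • p.1 := by fun_prop
  have h3 := ((ContinuousLinearMap.flipₗᵢ ℝ E3 E3 E3).continuous.comp (h2.comp hp)).clm_apply
    (continuous_const (y := e))
  have h4 := (innerSL ℝ (E := E3)).continuous.comp
    ((h1.comp hp).clm_apply (continuous_const (y := e)))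
  have h5 := ((innerSL ℝ (E := E3)).continuous.comp
    ((continuous_fst (Y := ℝ)).sub (continuous_const (y := x)))).clm_comp h3
  have h6 := (continuous_const (y := innerSL ℝ e)).clm_comp (h1.comp hp)
  exact ((continuous_const.sub continuous_snd).smul (h4.add (continuous_snd.smul h5))).sub
    (continuous_snd.smul h6)

theorem hasFDerivAt_edgeFDeriv_apply {u : E3 → E3} (hu : ContDiff ℝ 2 u) (x e y : E3) :
    HasFDerivAt (fun y => edgeFDeriv u x y e)
      (∫ a in (0:ℝ)..(1:ℝ), edgeIntegrandMixed u x e y a) y := by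
  have hu1 : ContDiff ℝ 1 u := hu.of_le one_le_two
  have h0 := hu.continuous
  have h1 := hu.continuous_fderiv two_ne_zero
  have hd : Differentiable ℝ (fderiv ℝ u) :=
    (hu.fderiv_right (m := 1) (by norm_num)).differentiable one_ne_zero
  simp_rw [edgeFDeriv_apply hu1]
  refine hasFDerivAt_integral_of_continuous_fderiv (fun x => by fun_prop)
    (continuous_edgeIntegrandMixed hu x e) (fun y a => ?_) y
  have hp : HasFDerivAt (fun y : E3 => (1 - a) • x + a • y)
      (a • ContinuousLinearMap.id ℝ E3) y :=
    ((hasFDerivAt_id y).const_smul a).const_add _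
  have hD := ((hd _).hasFDerivAt.comp y hp).clm_apply (hasFDerivAt_const e y)
  have hU := (hu1.differentiable one_ne_zero _).hasFDerivAt.comp y hp
  have h := ((((hasFDerivAt_id y).sub_const x).inner ℝ hD).const_mul (1 - a)).sub
    (hU.inner ℝ (hasFDerivAt_const e y))
  refine h.congr_fderiv ?_
  ext v
  simp [edgeIntegrandMixed, inner_sub_left, inner_smul_left, inner_smul_right, real_inner_comm]
  ring

theorem integral_edgeIntegrandMixed_sub {u : E3 → E3} (hu : ContDiff ℝ 2 u) (x y v e : E3) :
    (∫ a in (0:ℝ)..(1:ℝ), edgeIntegrandMixed u x e y a) v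
      - (∫ a in (0:ℝ)..(1:ℝ), edgeIntegrandMixed u x v y a) e
      = ∫ a in (0:ℝ)..(1:ℝ), (⟪v, fderiv ℝ u ((1 - a) • x + a • y) e⟫
        - ⟪e, fderiv ℝ u ((1 - a) • x + a • y) v⟫) := by
  have hc : ∀ e, Continuous (edgeIntegrandMixed u x e y) := fun e =>
    (continuous_edgeIntegrandMixed hu x e).comp (Continuous.prodMk_right y)
  rw [ContinuousLinearMap.intervalIntegral_apply ((hc e).intervalIntegrable _ _),
    ContinuousLinearMap.intervalIntegral_apply ((hc v).intervalIntegrable _ _),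
    ← intervalIntegral.integral_sub
      (((hc e).clm_apply continuous_const).intervalIntegrable _ _)
      (((hc v).clm_apply continuous_const).intervalIntegrable _ _)]
  refine intervalIntegral.integral_congr fun a _ => ?_
  have hs := (hu.contDiffAt (x := (1 - a) • x + a • y)).isSymmSndFDerivAt (by simp) v e
  simp only [edgeIntegrandMixed, sub_apply, smul_apply,
    add_apply, ContinuousLinearMap.comp_apply, innerSL_apply_apply,
    ContinuousLinearMap.flip_apply, smul_eq_mul, hs]
  rw [real_inner_comm v, real_inner_comm e]
  ring

/-- The curl as a linear function of the Jacobian. -/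
def curlLin : (E3 →L[ℝ] E3) →ₗ[ℝ] E3 where
  toFun A := vec3 (A (e3 1) 2 - A (e3 2) 1) (A (e3 2) 0 - A (e3 0) 2) (A (e3 0) 1 - A (e3 1) 0)
  map_add' A B := by
    ext i
    fin_cases i <;> simp [vec3] <;> ring
  map_smul' c A := by
    ext i
    fin_cases i <;> simp [vec3] <;> ring

theorem curl3_eq_comp (u : E3 → E3) :
    curl3 u = curlLin.toContinuousLinearMap ∘ fderiv ℝ u := rfl

theorem contDiff_curl3 {u : E3 → E3} (hu : ContDiff ℝ 2 u) : ContDiff ℝ 1 (curl3 u) := by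
  rw [curl3_eq_comp]
  exact (ContinuousLinearMap.contDiff _).comp (hu.fderiv_right (m := 1) (by norm_num))

theorem norm_fderiv_curl3_le_supDeriv {u : E3 → E3} (hu : ContDiff ℝ 2 u) {M : ℝ}
    (hM : ∀ x, ‖iteratedFDeriv ℝ 2 u x‖ ≤ M) (x : E3) :
    ‖fderiv ℝ (curl3 u) x‖ ≤ supDeriv 1 (curl3 u) := by
  rw [← norm_iteratedFDeriv_one]
  refine le_ciSup (f := fun x => ‖iteratedFDeriv ℝ 1 (curl3 u) x‖)
    ⟨‖curlLin.toContinuousLinearMap‖ * M, ?_⟩ x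
  rintro _ ⟨z, rfl⟩
  refine (ContinuousLinearMap.norm_iteratedFDeriv_comp_left curlLin.toContinuousLinearMap
    (f := fderiv ℝ u) (x := z)
    (hu.fderiv_right (m := 1) (by norm_num)).contDiffAt le_rfl).trans ?_
  rw [norm_iteratedFDeriv_fderiv]
  gcongr
  exact hM z

theorem vgradR_apply (k : Fin N) (F : (Fin N → E3) → ℝ) (C : Fin N → E3) (j : Fin 3) :
    vgradR k F C j = vpdR k j F C := by
  have h := InnerProductSpace.toDual_symm_apply (𝕜 := ℝ) (x := e3 j)
    (y := fderiv ℝ (fun x => F (Function.update C k x)) (C k))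
  rw [vpdR, ← h, e3, EuclideanSpace.inner_single_right]
  simp [vgradR, gradient]

section Vertices

variable [NeZero N]

theorem fin_add_one_ne_self (hN : 3 ≤ N) (k : Fin N) : k + 1 ≠ k := by
  intro h
  have h1 : (1 : Fin N) = 0 := by simpa using h
  have := congrArg Fin.val h1
  rw [Fin.val_one', Nat.mod_eq_of_lt (by omega)] at this
  simp at this

theorem fin_sub_one_ne_self (hN : 3 ≤ N) (k : Fin N) : k - 1 ≠ k := fun h =>
  fin_add_one_ne_self hN (k - 1) (by rw [sub_add_cancel, h])

theorem fin_sub_one_ne_add_one (hN : 3 ≤ N) (k : Fin N) : k - 1 ≠ k + 1 := by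
  intro h
  have h1 : (1 : Fin N) + 1 = 0 := by
    have := congrArg (fun j => j - k + 1) h
    simpa using this.symm
  have := congrArg Fin.val h1
  rw [Fin.val_add, Fin.val_one', Nat.mod_eq_of_lt (show 1 < N by omega),
    Nat.mod_eq_of_lt (by omega)] at this
  simp at this

theorem circulation_update (hN : 3 ≤ N) (u : E3 → E3) (C : Fin N → E3) (k : Fin N) (x : E3) :
    circulation N u (Function.update C k x) = edgeCirc u x (C (k + 1)) + edgeCirc u (C (k - 1)) x
      + ∑ j ∈ (Finset.univ.erase k).erase (k - 1), edgeCirc u (C j) (C (j + 1)) := by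
  change ∑ j, edgeCirc u (Function.update C k x j) (Function.update C k x (j + 1)) = _
  have hk := fin_sub_one_ne_self hN k
  rw [← Finset.add_sum_erase _ _ (Finset.mem_univ k),
    ← Finset.add_sum_erase _ _ (Finset.mem_erase.2 ⟨hk, Finset.mem_univ _⟩), ← add_assoc]
  congr 1
  · simp [Function.update_of_ne hk, Function.update_of_ne (fin_add_one_ne_self hN k)]
  · refine Finset.sum_congr rfl fun j hj => ?_
    simp only [Finset.mem_erase, Finset.mem_univ, and_true] at hj
    rw [Function.update_of_ne hj.2, Function.update_of_ne fun h => hj.1 (eq_sub_of_add_eq h)]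

theorem hasFDerivAt_circulation_update (hN : 3 ≤ N) {u : E3 → E3} (hu : ContDiff ℝ 1 u)
    (C : Fin N → E3) (k : Fin N) :
    HasFDerivAt (fun x => circulation N u (Function.update C k x))
      (edgeFDeriv u (C k) (C (k + 1)) - edgeFDeriv u (C k) (C (k - 1))) (C k) := by
  simp_rw [circulation_update hN]
  rw [sub_eq_add_neg]
  exact ((hasFDerivAt_edgeCirc_left hu _ _).add (hasFDerivAt_edgeCirc_right hu _ _)).add_const _

theorem vpdR_circulation (hN : 3 ≤ N) {u : E3 → E3} (hu : ContDiff ℝ 1 u)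
    (C : Fin N → E3) (k : Fin N) (j : Fin 3) :
    vpdR k j (circulation N u) C = edgeFDeriv u (C k) (C (k + 1)) (e3 j)
      - edgeFDeriv u (C k) (C (k - 1)) (e3 j) := by
  rw [vpdR, (hasFDerivAt_circulation_update hN hu C k).fderiv]
  rfl

theorem hasFDerivAt_vpdR_circulation_update (hN : 3 ≤ N) {u : E3 → E3} (hu : ContDiff ℝ 2 u)
    (C : Fin N → E3) (k : Fin N) (j : Fin 3) :
    HasFDerivAt (fun y => vpdR k j (circulation N u) (Function.update C (k + 1) y))
      (∫ a in (0:ℝ)..(1:ℝ), edgeIntegrandMixed u (C k) (e3 j) (C (k + 1)) a) (C (k + 1)) := by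
  simp_rw [vpdR_circulation hN (hu.of_le one_le_two), Function.update_self,
    Function.update_of_ne (fin_add_one_ne_self hN k).symm,
    Function.update_of_ne (fin_sub_one_ne_add_one hN k)]
  exact (hasFDerivAt_edgeFDeriv_apply hu _ _ _).sub_const _

theorem gradCross_circulation (hN : 3 ≤ N) {u : E3 → E3} (hu : ContDiff ℝ 2 u)
    (C : Fin N → E3) (k : Fin N) :
    gradCross (k + 1) k (circulation N u) C
      = -∫ a in (0:ℝ)..(1:ℝ), curl3 u ((1 - a) • C k + a • C (k + 1)) := by
  have hm : ∀ i j, vpdR (k + 1) i (vpdR k j (circulation N u)) C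
      = (∫ a in (0:ℝ)..(1:ℝ), edgeIntegrandMixed u (C k) (e3 j) (C (k + 1)) a) (e3 i) :=
    fun i j => by
      rw [vpdR, (hasFDerivAt_vpdR_circulation_update hN hu C k j).fderiv]
  have hc : Continuous fun a : ℝ => curl3 u ((1 - a) • C k + a • C (k + 1)) :=
    (contDiff_curl3 hu).continuous.comp (by fun_prop)
  rw [← intervalIntegral.integral_neg]
  ext i
  have hi := (EuclideanSpace.proj (𝕜 := ℝ) i).intervalIntegral_comp_comm (μ := volume)
    (hc.neg.intervalIntegrable 0 1)
  refine Eq.trans ?_ hi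
  simp only [gradCross, hm, integral_edgeIntegrandMixed_sub hu]
  fin_cases i <;> simp [vec3, curl3, e3, EuclideanSpace.inner_single_left]

theorem norm_gradCross_circulation_add_segAvg_le (hN : 3 ≤ N) {u : E3 → E3}
    (hu : ContDiff ℝ 2 u) {M : ℝ} (hM : ∀ x, ‖iteratedFDeriv ℝ 2 u x‖ ≤ M)
    (C : Fin N → E3) (k : Fin N) :
    ‖gradCross (k + 1) k (circulation N u) C
        + segAvg (curl3 u) (C (k - 1)) (C k) (C (k + 1))‖
      ≤ supDeriv 1 (curl3 u) * ‖C (k + 1) - C (k - 1)‖ := by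
  have hω := contDiff_curl3 hu
  have hω0 := hω.continuous
  have hS := norm_fderiv_curl3_le_supDeriv hu hM
  have hS0 : 0 ≤ supDeriv 1 (curl3 u) := (norm_nonneg _).trans (hS 0)
  have h := intervalIntegral.integral_comp_sub_left (a := 0) (b := 1)
    (fun a : ℝ => curl3 u ((1 - a) • C k + a • C (k + 1))) 1
  simp only [sub_self, sub_zero, sub_sub_cancel] at h
  have h1 : Continuous fun a : ℝ =>
      curl3 u (a • C k + (1 - a) • ((2:ℝ)⁻¹ • (C (k - 1) + C (k + 1)))) := by fun_prop
  have h2 : Continuous fun a : ℝ => curl3 u (a • C k + (1 - a) • C (k + 1)) := by fun_prop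
  rw [gradCross_circulation hN hu, ← h, segAvg, neg_add_eq_sub,
    ← intervalIntegral.integral_sub (μ := volume) (h1.intervalIntegrable 0 1)
      (h2.intervalIntegrable 0 1)]
  refine (intervalIntegral.norm_integral_le_of_norm_le_const
    (C := supDeriv 1 (curl3 u) * ‖C (k + 1) - C (k - 1)‖) fun a ha => ?_).trans (by simp)
  rw [Set.uIoc_of_le zero_le_one] at ha
  refine (convex_univ.norm_image_sub_le_of_norm_fderiv_le (𝕜 := ℝ)
    (fun x _ => hω.differentiable one_ne_zero x) (fun x _ => hS x)
    (Set.mem_univ _) (Set.mem_univ _)).trans ?_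
  gcongr
  have he : a • C k + (1 - a) • ((2:ℝ)⁻¹ • (C (k - 1) + C (k + 1))) - (a • C k + (1 - a) • C (k + 1))
      = -(((1 - a) * 2⁻¹) • (C (k + 1) - C (k - 1))) := by
    module
  rw [he, norm_neg, norm_smul, Real.norm_of_nonneg (by linarith [ha.2])]
  exact mul_le_of_le_one_left (norm_nonneg _) (by linarith [ha.1])

theorem vpd_loopExp (hN : 3 ≤ N) {u : E3 → E3} (hu : ContDiff ℝ 1 u) (γ ν : ℝ)
    (C : Fin N → E3) (k : Fin N) (j : Fin 3) :
    vpd k j (loopExp γ ν N u) C = Complex.I * γ / ν * loopExp γ ν N u C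
      * vpdR k j (circulation N u) C := by
  have h := hasFDerivAt_circulation_update hN hu C k
  have h2 := ((Complex.ofRealCLM.hasFDerivAt.comp (C k) h).const_mul (Complex.I * γ / ν)).cexp
  have h3 : fderiv ℝ (fun x => loopExp γ ν N u (Function.update C k x)) (C k) = _ := h2.fderiv
  rw [vpd, h3, vpdR, h.fderiv]
  simp [loopExp]
  ring

theorem vpd_vpd_loopExp (hN : 3 ≤ N) {u : E3 → E3} (hu : ContDiff ℝ 2 u) (γ ν : ℝ)
    (C : Fin N → E3) (k : Fin N) (i j : Fin 3) :
    vpd (k + 1) i (vpd k j (loopExp γ ν N u)) C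
      = Complex.I * γ / ν * loopExp γ ν N u C
          * vpdR (k + 1) i (vpdR k j (circulation N u)) C
        + (Complex.I * γ / ν) ^ 2 * loopExp γ ν N u C
          * (vpdR (k + 1) i (circulation N u) C * vpdR k j (circulation N u) C) := by
  have hu1 : ContDiff ℝ 1 u := hu.of_le one_le_two
  have h := hasFDerivAt_circulation_update hN hu1 C (k + 1)
  have h2 := ((Complex.ofRealCLM.hasFDerivAt.comp _ h).const_mul (Complex.I * γ / ν)).cexp
  have hg := hasFDerivAt_vpdR_circulation_update hN hu C k j
  have h3 := (h2.const_mul (Complex.I * γ / ν)).mul (Complex.ofRealCLM.hasFDerivAt.comp _ hg)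
  have h4 : fderiv ℝ (fun y => Complex.I * γ / ν * loopExp γ ν N u (Function.update C (k + 1) y)
      * (vpdR k j (circulation N u) (Function.update C (k + 1) y) : ℂ)) (C (k + 1)) = _ := h3.fderiv
  rw [vpd]
  simp_rw [vpd_loopExp hN hu1]
  rw [h4, vpdR, vpdR, h.fderiv, hg.fderiv]
  simp [loopExp]
  ring

end Vertices

/-! ## Statement 4 -/
theorem stmt_4 :
    ∃ c > (0:ℝ), ∀ γ ν : ℝ, 0 < γ → 0 < ν →
      ∀ (N : ℕ) [NeZero N], 3 ≤ N →
      ∀ u : E3 → E3, ContDiff ℝ 2 u → (∀ j ≤ 2, ∃ M, ∀ x, ‖iteratedFDeriv ℝ j u x‖ ≤ M) →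
      ∀ (C : Fin N → E3) (k : Fin N),
        vortOp γ ν k (loopExp γ ν N u) C =
              loopExp γ ν N u C • toC3 (segAvg (curl3 u) (C (k - 1)) (C k) (C (k + 1)))
            - loopExp γ ν N u C • toC3
                (gradCross (k + 1) k (circulation N u) C
                  + segAvg (curl3 u) (C (k - 1)) (C k) (C (k + 1)))
            - (Complex.I * γ / ν * loopExp γ ν N u C) • toC3
                (cross3 (vgradR (k + 1) (circulation N u) C) (vgradR k (circulation N u) C)) ∧
        ‖gradCross (k + 1) k (circulation N u) C
              + segAvg (curl3 u) (C (k - 1)) (C k) (C (k + 1))‖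
            ≤ c * supDeriv 1 (curl3 u) * ‖C (k + 1) - C (k - 1)‖ := by
  refine ⟨1, one_pos, fun γ ν hγ hν N _ hN u hu hb C k => ⟨?_, ?_⟩⟩
  · have hγ' : (γ : ℂ) ≠ 0 := by exact_mod_cast hγ.ne'
    have hν' : (ν : ℂ) ≠ 0 := by exact_mod_cast hν.ne'
    have h1 : Complex.I * ν / γ * (Complex.I * γ / ν) = -1 := by
      field_simp
      exact Complex.I_sq
    have key : ∀ P A B X Y : ℂ, Complex.I * ν / γ * (Complex.I * γ / ν * P * A
        + (Complex.I * γ / ν) ^ 2 * P * X - (Complex.I * γ / ν * P * B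
        + (Complex.I * γ / ν) ^ 2 * P * Y))
        = -(P * (A - B)) - Complex.I * γ / ν * P * (X - Y) := fun P A B X Y => by
      linear_combination (P * (A - B) + Complex.I * γ / ν * P * (X - Y)) * h1
    funext i
    fin_cases i <;>
    · simp [vortOp, opCross, vpd_vpd_loopExp hN hu, toC3, cross3, gradCross, vec3, vgradR_apply,
        key]
      ring
  · obtain ⟨M, hM⟩ := hb 2 le_rfl
    rw [one_mul]
    exact norm_gradCross_circulation_add_segAvg_le hN hu hM C k

end
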